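/- Let R be a nontrivial commutative ring with 2 = 0 in R. Let M = (Fin 2 → R) × (Fin 2 → R) with hyperbolic quadratic form Q(x, y) = x(0)·y(0) + x(1)·y(1), Clifford algebra Cl(Q), generators e_i = ι(δ_i, 0), and canonical involution reverse. Then the element e₀·e₁ does not lie in the image of the linear map (id − reverse) : Cl(Q) → Cl(Q), i.e., e₀·e₁ is not an alternating element, even though it corresponds to a trace-zero element under the canonical map. -/

import Mathlib

open CliffordAlgebra

/-- The bilinear map `((x, y), (x', y')) ↦ Σ_i x i * y' i` on `(Fin n → R) × (Fin n → R)`. -/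
noncomputable def hypBilin (R : Type*) [CommRing R] (n : ℕ) :
    ((Fin n → R) × (Fin n → R)) →ₗ[R] ((Fin n → R) × (Fin n → R)) →ₗ[R] R :=
  LinearMap.mk₂ R (fun p q => ∑ i, p.1 i * q.2 i)
    (fun m₁ m₂ q => by simp [add_mul, Finset.sum_add_distrib])
    (fun c m q => by simp [Finset.mul_sum, mul_assoc])
    (fun m q₁ q₂ => by simp [mul_add, Finset.sum_add_distrib])
    (fun c m q => by simp [Finset.mul_sum, mul_left_comm])

/-- The hyperbolic quadratic form `Q(x, y) = Σ_i x i * y i` on `(Fin n → R) × (Fin n → R)`. -/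
noncomputable def hypQ (R : Type*) [CommRing R] (n : ℕ) :
    QuadraticForm R ((Fin n → R) × (Fin n → R)) :=
  LinearMap.BilinMap.toQuadraticMap (hypBilin R n)

/-- The generator `e_i = ι(δ_i, 0)`. -/
noncomputable def eGen (R : Type*) [CommRing R] (i : Fin 2) : CliffordAlgebra (hypQ R 2) :=
  ι (hypQ R 2) (Pi.single i (1 : R), 0)

/-- The action of a vector of the hyperbolic space on the spinor module `Λ(e₀, e₁)`, in
characteristic 2, with respect to the basis `1, e₀, e₁, e₀e₁`. -/
def spinorMatrix (R : Type*) [CommRing R] :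
    ((Fin 2 → R) × (Fin 2 → R)) →ₗ[R] Matrix (Fin 4) (Fin 4) R where
  toFun m := !![0, m.2 0, m.2 1, 0;
                m.1 0, 0, 0, m.2 1;
                m.1 1, 0, 0, m.2 0;
                0, m.1 1, m.1 0, 0]
  map_add' m m' := by ext i j; fin_cases i <;> fin_cases j <;> simp
  map_smul' c m := by ext i j; fin_cases i <;> fin_cases j <;> simp

theorem spinorMatrix_mul_self {R : Type*} [CommRing R] (h2 : (2 : R) = 0)
    (m : (Fin 2 → R) × (Fin 2 → R)) :
    spinorMatrix R m * spinorMatrix R m = algebraMap R _ (hypQ R 2 m) := by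
  ext i j
  fin_cases i <;> fin_cases j <;>
    simp [spinorMatrix, hypQ, hypBilin, Matrix.mul_apply, Fin.sum_univ_four,
      Matrix.algebraMap_matrix_apply] <;> grind

/-- The spinor representation of the Clifford algebra of the hyperbolic plane of rank 4, in
characteristic 2. -/
noncomputable def spinorRep {R : Type*} [CommRing R] (h2 : (2 : R) = 0) :
    CliffordAlgebra (hypQ R 2) →ₐ[R] Matrix (Fin 4) (Fin 4) R :=
  CliffordAlgebra.lift (hypQ R 2) ⟨spinorMatrix R, spinorMatrix_mul_self h2⟩

@[simp]
theorem spinorRep_ι {R : Type*} [CommRing R] (h2 : (2 : R) = 0)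
    (m : (Fin 2 → R) × (Fin 2 → R)) :
    spinorRep h2 (ι (hypQ R 2) m) = spinorMatrix R m :=
  lift_ι_apply _ _ _

/-- The spinor representation turns `reverse` into reflection across the anti-diagonal. -/
theorem spinorRep_reverse {R : Type*} [CommRing R] (h2 : (2 : R) = 0)
    (x : CliffordAlgebra (hypQ R 2)) :
    spinorRep h2 (reverse x) = (spinorRep h2 x).transpose.submatrix Fin.rev Fin.rev := by
  induction x using CliffordAlgebra.induction with
  | algebraMap r =>
    ext i j
    simp [reverse.commutes, Matrix.algebraMap_matrix_apply, eq_comm]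
  | ι m =>
    rw [reverse_ι, spinorRep_ι]
    ext i j
    fin_cases i <;> fin_cases j <;> rfl
  | mul a b ha hb =>
    rw [reverse.map_mul, map_mul, map_mul, ha, hb, Matrix.transpose_mul]
    exact Matrix.submatrix_mul_equiv _ _ Fin.rev Fin.revPerm Fin.rev
  | add a b ha hb =>
    rw [map_add, map_add, map_add, ha, hb]
    rfl

/-- In degree 4 and characteristic 2, the even element `e₀e₁` is not alternating, even though
it corresponds to a trace-zero element under the canonical map. -/
theorem e01_not_alternating {R : Type*} [CommRing R] [Nontrivial R] (h2 : (2 : R) = 0) :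
    eGen R 0 * eGen R 1 ∉ LinearMap.range
      (LinearMap.id - (reverse (Q := hypQ R 2) :
        CliffordAlgebra (hypQ R 2) →ₗ[R] CliffordAlgebra (hypQ R 2))) := by
  rintro ⟨x, hx⟩
  have h := congrArg (fun y => spinorRep h2 y 3 0) hx
  simp only [LinearMap.sub_apply, LinearMap.id_apply, map_sub, spinorRep_reverse, eGen, map_mul,
    spinorRep_ι] at h
  have hrev : (Fin.rev 0 : Fin 4) = 3 ∧ (Fin.rev 3 : Fin 4) = 0 := by decide
  simp [hrev, spinorMatrix, Matrix.mul_apply, Fin.sum_univ_four] at h
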